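/- (Characterization of $r$-regularity by matrix inequalities.) Let $1 < r < \infty$, $1 \le q \le p < \infty$ with $[q,p] \cap [\min\{r,2\}, \max\{r,2\}] \ne \emptyset$, let $(\Omega,\Sigma,\mu)$, $(\Omega',\Sigma',\nu)$ be $\sigma$-finite measure spaces, let $r \le a < \infty$ and $1 < b \le r$, and let $T : L^a(\mu) \to L^b(\nu)$ be a bounded linear operator. The following are equivalent: (i) $T$ is $(r,r)$-regular with some constant; (ii) there is a constant $K > 0$ such that for every doubly indexed finite family $(x_{ij})_{i \le n, j \le m}$ in $L^a(\mu)$: $\big\| \big(\sum_{i=1}^n (\sum_{j=1}^m |T x_{ij}|^p)^{r/p}\big)^{1/r} \big\|_{L^b(\nu)} \le K \big\| \big(\sum_{i=1}^n (\sum_{j=1}^m |x_{ij}|^q)^{r/q}\big)^{1/r} \big\|_{L^a(\mu)}$. -/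

import Mathlib

open MeasureTheory ENNReal

/-- `T` is `(p,q)`-regular with constant `K`. -/
def IsPQRegular {Ω Ω' : Type*} [MeasurableSpace Ω] [MeasurableSpace Ω']
    {μ : Measure Ω} {ν : Measure Ω'} {u v : ℝ≥0∞}
    (T : Lp ℝ u μ → Lp ℝ v ν) (p q K : ℝ) : Prop :=
  ∀ (n : ℕ) (f : Fin n → Lp ℝ u μ),
    eLpNorm (fun ω' => (∑ i, |T (f i) ω'| ^ p) ^ (1 / p)) v ν ≤
      ENNReal.ofReal K * eLpNorm (fun ω => (∑ i, |f i ω| ^ q) ^ (1 / q)) u μ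

theorem Real.sum_rpow_le_sum_rpow {ι : Type*} (s : Finset ι) (f : ι → ℝ) (hf : ∀ i ∈ s, 0 ≤ f i)
    {t : ℝ} (ht : 1 ≤ t) : ∑ i ∈ s, f i ^ t ≤ (∑ i ∈ s, f i) ^ t := by
  have h0 : 0 ≤ ∑ i ∈ s, f i := Finset.sum_nonneg hf
  calc ∑ i ∈ s, f i ^ t ≤ ∑ i ∈ s, f i * (∑ i ∈ s, f i) ^ (t - 1) := by
        refine Finset.sum_le_sum fun i hi => ?_
        rcases (hf i hi).eq_or_lt with h | h
        · rw [← h, Real.zero_rpow (by linarith), zero_mul]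
        · calc f i ^ t = f i * f i ^ (t - 1) := by
                rw [Real.rpow_sub_one h.ne']; field_simp
            _ ≤ _ := by
              have hle := Finset.single_le_sum hf hi
              exact mul_le_mul_of_nonneg_left (Real.rpow_le_rpow h.le hle (by linarith)) h.le
    _ = (∑ i ∈ s, f i) ^ t := by
        rw [← Finset.sum_mul]
        rcases h0.eq_or_lt with h | h
        · rw [← h, zero_mul, Real.zero_rpow (by linarith)]
        · rw [Real.rpow_sub_one h.ne']; field_simp

theorem Real.rpow_sum_le_sum_rpow {ι : Type*} (s : Finset ι) (f : ι → ℝ) (hf : ∀ i ∈ s, 0 ≤ f i)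
    {t : ℝ} (h0 : 0 < t) (ht : t ≤ 1) : (∑ i ∈ s, f i) ^ t ≤ ∑ i ∈ s, f i ^ t := by
  have h := Real.sum_rpow_le_sum_rpow s (fun i => f i ^ t)
    (fun i hi => Real.rpow_nonneg (hf i hi) _) (t := 1 / t) (by rw [le_div_iff₀ h0]; linarith)
  have h1 : ∑ i ∈ s, (f i ^ t) ^ (1 / t) = ∑ i ∈ s, f i :=
    Finset.sum_congr rfl fun i hi => by
      rw [← Real.rpow_mul (hf i hi), mul_one_div_cancel h0.ne', Real.rpow_one]
  rw [h1] at h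
  calc _ ≤ ((∑ i ∈ s, f i ^ t) ^ (1 / t)) ^ t := by
        gcongr; exact Finset.sum_nonneg hf
    _ = _ := by
      rw [← Real.rpow_mul (Finset.sum_nonneg fun i hi => Real.rpow_nonneg (hf i hi) _),
        one_div_mul_cancel h0.ne', Real.rpow_one]

theorem Real.rpow_sum_rpow_anti {ι : Type*} (s : Finset ι) (f : ι → ℝ) (hf : ∀ i ∈ s, 0 ≤ f i)
    {p q : ℝ} (hq : 0 < q) (hqp : q ≤ p) :
    (∑ i ∈ s, f i ^ p) ^ (1 / p) ≤ (∑ i ∈ s, f i ^ q) ^ (1 / q) := by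
  have hp : 0 < p := hq.trans_le hqp
  have hn : 0 ≤ ∑ i ∈ s, f i ^ q := Finset.sum_nonneg fun i hi => Real.rpow_nonneg (hf i hi) _
  have h := Real.sum_rpow_le_sum_rpow s (fun i => f i ^ q)
    (fun i hi => Real.rpow_nonneg (hf i hi) _) (t := p / q) (by rw [le_div_iff₀ hq]; linarith)
  have h1 : ∑ i ∈ s, (f i ^ q) ^ (p / q) = ∑ i ∈ s, f i ^ p :=
    Finset.sum_congr rfl fun i hi => by
      rw [← Real.rpow_mul (hf i hi), mul_div_cancel₀ _ hq.ne']
  rw [h1] at h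
  calc _ ≤ ((∑ i ∈ s, f i ^ q) ^ (p / q)) ^ (1 / p) := by
        gcongr
        exact Finset.sum_nonneg fun i hi => Real.rpow_nonneg (hf i hi) _
    _ = _ := by
      rw [← Real.rpow_mul hn]; congr 1; field_simp

/-- The sign `±1` attached to a Boolean. -/
def boolSign (b : Bool) : ℝ := if b then 1 else -1

theorem sum_bool_cons {m : ℕ} (F : (Fin (m + 1) → Bool) → ℝ) :
    ∑ e, F e = ∑ e : Fin m → Bool, (F (Fin.cons true e) + F (Fin.cons false e)) := by
  rw [← (Fin.consEquiv fun _ => Bool).sum_comp, Fintype.sum_prod_type, Fintype.sum_bool,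
    ← Finset.sum_add_distrib]
  rfl

theorem sum_boolSign_sq (m : ℕ) (y : Fin m → ℝ) :
    ∑ e : Fin m → Bool, (∑ j, boolSign (e j) * y j) ^ 2 = 2 ^ m * ∑ j, y j ^ 2 := by
  induction m with
  | zero => simp
  | succ m ih =>
    rw [sum_bool_cons]
    have := ih fun j => y j.succ
    simp only [Fin.sum_univ_succ, Fin.cons_zero, Fin.cons_succ]
    have h : ∀ S : ℝ, (boolSign true * y 0 + S) ^ 2 + (boolSign false * y 0 + S) ^ 2
      = 2 * S ^ 2 + 2 * y 0 ^ 2 := fun S => by simp [boolSign]; ring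
    simp only [h, Finset.sum_add_distrib, ← Finset.mul_sum, this]
    simp
    ring

theorem sum_boolSign_pow_four (m : ℕ) (y : Fin m → ℝ) :
    ∑ e : Fin m → Bool, (∑ j, boolSign (e j) * y j) ^ 4 ≤ 3 * 2 ^ m * (∑ j, y j ^ 2) ^ 2 := by
  induction m with
  | zero => simp
  | succ m ih =>
    rw [sum_bool_cons]
    have h4 := ih fun j => y j.succ
    have h2 := sum_boolSign_sq m fun j => y j.succ
    simp only [Fin.sum_univ_succ, Fin.cons_zero, Fin.cons_succ]
    have h : ∀ S : ℝ, (boolSign true * y 0 + S) ^ 4 + (boolSign false * y 0 + S) ^ 4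
      = 2 * S ^ 4 + 12 * y 0 ^ 2 * S ^ 2 + 2 * y 0 ^ 4 := fun S => by simp [boolSign]; ring
    simp only [h, Finset.sum_add_distrib, ← Finset.mul_sum, h2]
    simp only [Finset.sum_const, Finset.card_univ, Fintype.card_fun, Fintype.card_bool,
      Fintype.card_fin, nsmul_eq_mul]
    push_cast
    have : (0 : ℝ) ≤ 2 ^ m * y 0 ^ 4 := by positivity
    rw [pow_succ (2 : ℝ) m]
    nlinarith

/-- Khintchine's inequality for exponents at most `2`, on the unit sphere. -/
theorem khintchine_of_sum_sq_eq_one {r : ℝ} (hr : 0 < r) (hr2 : r ≤ 2) (m : ℕ) (y : Fin m → ℝ)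
    (hy : ∑ j, y j ^ 2 = 1) :
    2 ^ m / 12 ≤ ∑ e : Fin m → Bool, |∑ j, boolSign (e j) * y j| ^ r ∧
      ∑ e : Fin m → Bool, |∑ j, boolSign (e j) * y j| ^ r ≤ 2 ^ m * 2 := by
  have h2 := sum_boolSign_sq m y
  have h4 := sum_boolSign_pow_four m y
  rw [hy] at h2 h4
  have key : ∀ t : ℝ, t ^ 2 ≤ 6 * |t| ^ r + t ^ 4 / 6 := by
    intro t
    have hp : 0 ≤ |t| ^ r := by positivity
    by_cases ht : t ^ 2 ≤ 6
    · have : t ^ 2 ≤ 6 * |t| ^ r := by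
        rcases le_or_gt |t| 1 with h | h
        · have : |t| ^ (2 : ℝ) ≤ |t| ^ r :=
            Real.rpow_le_rpow_of_exponent_ge_of_imp (abs_nonneg t) h hr2 (fun _ h => by linarith)
          rw [Real.rpow_two, sq_abs] at this
          linarith
        · have : 1 ≤ |t| ^ r := Real.one_le_rpow h.le hr.le
          linarith
      have : 0 ≤ t ^ 4 := by positivity
      linarith
    · push Not at ht
      nlinarith
  have key2 : ∀ t : ℝ, |t| ^ r ≤ 1 + t ^ 2 := by
    intro t
    rcases le_or_gt |t| 1 with h | h
    · have : |t| ^ r ≤ 1 := Real.rpow_le_one (abs_nonneg t) h hr.le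
      nlinarith [sq_nonneg t]
    · have : |t| ^ r ≤ |t| ^ (2 : ℝ) := Real.rpow_le_rpow_of_exponent_le h.le hr2
      rw [Real.rpow_two, sq_abs] at this
      linarith
  constructor
  · have := Finset.sum_le_sum fun (e : Fin m → Bool) (_ : e ∈ Finset.univ) =>
      key (∑ j, boolSign (e j) * y j)
    rw [Finset.sum_add_distrib, ← Finset.mul_sum, ← Finset.sum_div, h2] at this
    linarith
  · have := Finset.sum_le_sum fun (e : Fin m → Bool) (_ : e ∈ Finset.univ) =>
      key2 (∑ j, boolSign (e j) * y j)
    rw [Finset.sum_add_distrib, h2] at this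
    simp at this
    linarith

theorem khintchine {r : ℝ} (hr : 0 < r) (hr2 : r ≤ 2) (m : ℕ) (y : Fin m → ℝ) :
    2 ^ m / 12 * (∑ j, y j ^ 2) ^ (r / 2) ≤ ∑ e : Fin m → Bool, |∑ j, boolSign (e j) * y j| ^ r ∧
      ∑ e : Fin m → Bool, |∑ j, boolSign (e j) * y j| ^ r ≤
        2 ^ m * 2 * (∑ j, y j ^ 2) ^ (r / 2) := by
  have hn : 0 ≤ ∑ j, y j ^ 2 := Finset.sum_nonneg fun _ _ => sq_nonneg _
  rcases hn.eq_or_lt with h | h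
  · have hy : ∀ j, y j = 0 := fun j => by
      have := (Finset.sum_eq_zero_iff_of_nonneg fun j _ => sq_nonneg (y j)).1 h.symm j
        (Finset.mem_univ _)
      simpa using this
    simp [hy, hr.ne']
  · set σ := √(∑ j, y j ^ 2) with hσ
    have hσ0 : 0 < σ := Real.sqrt_pos.2 h
    have hσ2 : ∑ j, y j ^ 2 = σ ^ 2 := (Real.sq_sqrt hn).symm
    have hk := khintchine_of_sum_sq_eq_one hr hr2 m (fun j => y j / σ) (by
      simp only [div_pow, ← Finset.sum_div, hσ2]
      field_simp)
    have e1 : ∀ e : Fin m → Bool, |∑ j, boolSign (e j) * (y j / σ)| ^ r =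
        |∑ j, boolSign (e j) * y j| ^ r / σ ^ r := fun e => by
      simp only [← mul_div_assoc, ← Finset.sum_div]
      rw [abs_div, abs_of_pos hσ0, Real.div_rpow (abs_nonneg _) hσ0.le]
    have hs : (∑ j, y j ^ 2) ^ (r / 2) = σ ^ r := by
      rw [hσ2, ← Real.rpow_natCast, ← Real.rpow_mul hσ0.le]
      congr 1; push_cast; ring
    simp only [e1, ← Finset.sum_div] at hk
    have hp : 0 < σ ^ r := by positivity
    rw [le_div_iff₀ hp, div_le_iff₀ hp] at hk
    rw [hs]
    exact hk

theorem geom_sum_le_inv {x : ℝ} (hx0 : 0 ≤ x) (hx1 : x < 1) (n : ℕ) :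
    ∑ i ∈ Finset.range n, x ^ i ≤ (1 - x)⁻¹ := by
  rw [← tsum_geometric_of_lt_one hx0 hx1]
  exact (summable_geometric_of_lt_one hx0 hx1).sum_le_tsum _ fun i _ => by positivity

/-- A dyadic Pareto law of index `s`: truncated moments and tails. -/
theorem exists_dyadic_pareto {r s : ℝ} (hr : 0 < r) (hrs : r < s) (hs : s < 2) :
    ∃ A > 0, ∃ B > 0, ∀ L : ℕ, ∃ p : Fin (L + 1) → ℝ, (∀ l, 0 ≤ p l) ∧ ∑ l, p l = 1 ∧
      (∀ t : ℝ, 0 ≤ t → t ≤ 1 →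
        ∑ l : Fin (L + 1), p l * (if 2 ^ (l : ℕ) * t ≤ 1 then (2 ^ (l : ℕ) * t) ^ 2
        else (2 ^ (l : ℕ) * t) ^ r) ≤ A * t ^ s) ∧
      (∀ t : ℝ, 0 < t → t ≤ 1 → 1 ≤ 2 ^ L * t →
        B * t ^ s ≤ ∑ l : Fin (L + 1), if 1 ≤ 2 ^ (l : ℕ) * t then p l else 0) := by
  have hs0 : 0 < s := hr.trans hrs
  set x : ℝ := 2 ^ (-s) with hx
  set α : ℝ := 2 ^ (-(2 - s)) with hα
  set β : ℝ := 2 ^ (-(s - r)) with hβ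
  have hx0 : 0 < x := by positivity
  have hα0 : 0 < α := by positivity
  have hβ0 : 0 < β := by positivity
  have hx1 : x < 1 := Real.rpow_lt_one_of_one_lt_of_neg (by norm_num) (by linarith)
  have hα1 : α < 1 := Real.rpow_lt_one_of_one_lt_of_neg (by norm_num) (by linarith)
  have hβ1 : β < 1 := Real.rpow_lt_one_of_one_lt_of_neg (by norm_num) (by linarith)
  have hpow : ∀ (u : ℝ) (d : ℕ), ((2 : ℝ) ^ u) ^ d = ((2 : ℝ) ^ d) ^ u := fun u d => by
    rw [← Real.rpow_natCast, ← Real.rpow_mul (by norm_num), mul_comm,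
      Real.rpow_mul (by norm_num), Real.rpow_natCast]
  refine ⟨(1 - α)⁻¹ + (1 - β)⁻¹, by
    have := inv_pos.2 (sub_pos.2 hα1); have := inv_pos.2 (sub_pos.2 hβ1); positivity,
    (1 - x) * x, mul_pos (sub_pos.2 hx1) hx0, fun L => ?_⟩
  set W := ∑ l : Fin (L + 1), x ^ (l : ℕ) with hW
  have hWr : W = ∑ l ∈ Finset.range (L + 1), x ^ l := by
    rw [hW, Finset.sum_range fun l => x ^ l]
  have hW1 : 1 ≤ W := by
    rw [hWr]
    have := Finset.single_le_sum (f := fun l => x ^ l) (s := Finset.range (L + 1))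
      (fun i _ => by positivity) (Finset.mem_range.2 (Nat.succ_pos L))
    simpa using this
  have hW2 : (1 - x) ≤ W⁻¹ := by
    rw [le_inv_comm₀ (sub_pos.2 hx1) (by linarith), hWr]
    exact geom_sum_le_inv hx0.le hx1 _
  refine ⟨fun l => x ^ (l : ℕ) / W, fun l => by positivity, by
    rw [← Finset.sum_div, div_self (by linarith)], fun t ht0 ht1 => ?_, fun t ht0 ht1 hL => ?_⟩
  · rcases ht0.eq_or_lt with h | h
    · subst h
      simp [hs0.ne']
    obtain ⟨n, hn1, hn2⟩ := exists_nat_pow_near (one_le_inv_iff₀.2 ⟨h, ht1⟩)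
      (show (1 : ℝ) < 2 by norm_num)
    have hn1' : 2 ^ n * t ≤ 1 := by rwa [← le_div_iff₀ h, one_div]
    have hn2' : 1 < 2 ^ (n + 1) * t := by rwa [← div_lt_iff₀ h, one_div]
    have hterm : ∀ l : ℕ, x ^ l * (if 2 ^ l * t ≤ 1 then (2 ^ l * t) ^ 2
        else (2 ^ l * t) ^ r) ≤ t ^ s * if l ≤ n then α ^ (n - l) else β ^ (l - (n + 1)) := by
      intro l
      have hy : 0 < 2 ^ l * t := by positivity
      have hxl : x ^ l = t ^ s * (2 ^ l * t) ^ (-s) := by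
        rw [hx, hpow, Real.mul_rpow (by positivity) h.le, mul_left_comm,
          ← Real.rpow_add h]
        simp
      rw [hxl, mul_assoc]
      refine mul_le_mul_of_nonneg_left ?_ (by positivity)
      by_cases hl : l ≤ n
      · have h2n : (2 : ℝ) ^ n = 2 ^ (n - l) * 2 ^ l := by
          rw [← pow_add, Nat.sub_add_cancel hl]
        have hle : 2 ^ l * t ≤ (2 ^ (n - l))⁻¹ := by
          rw [le_inv_comm₀ hy (by positivity), ← one_div, le_div_iff₀ hy, ← mul_assoc, ← h2n]
          exact hn1'
        have hle1 : 2 ^ l * t ≤ 1 := hle.trans (inv_le_one_of_one_le₀ (one_le_pow₀ (by norm_num)))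
        rw [if_pos hle1, if_pos hl, ← Real.rpow_natCast (2 ^ l * t) 2, ← Real.rpow_add hy, hα, hpow,
          Real.rpow_neg (by positivity), ← Real.inv_rpow (by positivity)]
        refine (Real.rpow_le_rpow hy.le hle (by push_cast; linarith)).trans_eq ?_
        congr 1; push_cast; ring
      · push Not at hl
        have h2n : (2 : ℝ) ^ l = 2 ^ (l - (n + 1)) * 2 ^ (n + 1) := by
          rw [← pow_add, Nat.sub_add_cancel hl]
        have hge : 2 ^ (l - (n + 1)) ≤ 2 ^ l * t := by
          rw [h2n, mul_assoc]
          exact le_mul_of_one_le_right (by positivity) hn2'.le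
        have hgt : ¬ 2 ^ l * t ≤ 1 := by
          rw [not_le, h2n, mul_assoc]
          exact hn2'.trans_le (le_mul_of_one_le_left (by positivity) (one_le_pow₀ (by norm_num)))
        rw [if_neg hgt, if_neg hl.not_ge, ← Real.rpow_add hy, hβ, hpow]
        refine (Real.rpow_le_rpow_of_nonpos (by positivity) hge (by linarith)).trans_eq ?_
        congr 1; ring
    have hsum : ∑ l : Fin (L + 1), (if (l : ℕ) ≤ n then α ^ (n - (l : ℕ)) else
        β ^ ((l : ℕ) - (n + 1))) ≤ (1 - α)⁻¹ + (1 - β)⁻¹ := by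
      rw [← Finset.sum_range fun l => if l ≤ n then α ^ (n - l) else β ^ (l - (n + 1))]
      calc _ ≤ ∑ l ∈ Finset.range (n + 1 + (L + 1)),
            (if l ≤ n then α ^ (n - l) else β ^ (l - (n + 1))) := by
            refine Finset.sum_le_sum_of_subset_of_nonneg
              (Finset.range_subset_range.2 (by omega)) fun i _ _ => ?_
            split_ifs <;> positivity
        _ = ∑ l ∈ Finset.range (n + 1), α ^ l + ∑ l ∈ Finset.range (L + 1), β ^ l := by
            rw [Finset.sum_range_add]
            congr 1
            · rw [← Finset.sum_range_reflect]
              refine Finset.sum_congr rfl fun i hi => ?_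
              have := Finset.mem_range.1 hi
              rw [if_pos (by omega)]
              congr 1
              omega
            · refine Finset.sum_congr rfl fun i hi => ?_
              rw [if_neg (by omega), Nat.add_sub_cancel_left]
        _ ≤ _ := add_le_add (geom_sum_le_inv hα0.le hα1 _) (geom_sum_le_inv hβ0.le hβ1 _)
    calc _ ≤ ∑ l : Fin (L + 1), t ^ s * (if (l : ℕ) ≤ n then α ^ (n - (l : ℕ)) else
        β ^ ((l : ℕ) - (n + 1))) := by
          refine Finset.sum_le_sum fun l _ => le_trans ?_ (hterm l)
          have : 0 ≤ (if 2 ^ (l : ℕ) * t ≤ 1 then (2 ^ (l : ℕ) * t) ^ 2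
            else (2 ^ (l : ℕ) * t) ^ r) := by split_ifs <;> positivity
          exact mul_le_mul_of_nonneg_right (div_le_self (by positivity) hW1) this
      _ ≤ _ := by
          rw [← Finset.mul_sum, mul_comm]
          exact mul_le_mul_of_nonneg_right hsum (by positivity)
  · obtain ⟨n, hn1, hn2⟩ := exists_nat_pow_near (one_le_inv_iff₀.2 ⟨ht0, ht1⟩)
      (show (1 : ℝ) < 2 by norm_num)
    have hn1' : 2 ^ n * t ≤ 1 := by rwa [← le_div_iff₀ ht0, one_div]
    have hn2' : 1 < 2 ^ (n + 1) * t := by rwa [← div_lt_iff₀ ht0, one_div]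
    have htail : x * t ^ s ≤ x ^ (n + 1) := by
      have : t ^ s ≤ x ^ n := by
        rw [hx, hpow, Real.rpow_neg (by positivity), ← Real.inv_rpow (by positivity)]
        refine Real.rpow_le_rpow ht0.le ?_ hs0.le
        rwa [le_inv_comm₀ ht0 (by positivity)]
      rw [pow_succ, mul_comm]
      exact mul_le_mul_of_nonneg_right this hx0.le
    have key : ∀ l : Fin (L + 1), 1 ≤ 2 ^ (l : ℕ) * t → x ^ (n + 1) ≤ x ^ (l : ℕ) →
        (1 - x) * x * t ^ s ≤ ∑ l : Fin (L + 1),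
          if 1 ≤ 2 ^ (l : ℕ) * t then x ^ (l : ℕ) / W else 0 := by
      intro l hl hxl
      have := Finset.single_le_sum
        (f := fun l : Fin (L + 1) => if 1 ≤ 2 ^ (l : ℕ) * t then x ^ (l : ℕ) / W else 0)
        (s := Finset.univ) (fun i _ => by split_ifs <;> positivity) (Finset.mem_univ l)
      refine le_trans ?_ this
      rw [if_pos hl, mul_assoc, div_eq_inv_mul]
      exact mul_le_mul hW2 (htail.trans hxl) (by positivity) (by positivity)
    by_cases hnL : n + 1 ≤ L
    · exact key ⟨n + 1, by omega⟩ hn2'.le le_rfl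
    · exact key ⟨L, by omega⟩ hL (pow_le_pow_of_le_one hx0.le hx1.le (by simp; omega))

theorem sum_prod_weights_mul {ι κ : Type*} [Fintype ι] [DecidableEq ι] [Fintype κ]
    (p : κ → ℝ) (hp : ∑ l, p l = 1) (g : κ → ℝ) (j : ι) :
    ∑ k : ι → κ, (∏ i, p (k i)) * g (k j) = ∑ l, p l * g l := by
  have h := Finset.prod_univ_sum (fun _ : ι => (Finset.univ : Finset κ))
    (fun i l => p l * if i = j then g l else 1)
  have h2 : ∀ i : ι, ∑ l, p l * (if i = j then g l else 1) =
      if i = j then ∑ l, p l * g l else 1 := fun i => by split_ifs <;> simp [hp]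
  simp only [h2, Finset.prod_ite_eq', Finset.mem_univ, if_true, Fintype.piFinset_univ,
    Finset.prod_mul_distrib] at h
  rw [h]

/-- Square functions of independent Pareto variables generate the `ℓ^s` norm. -/
theorem exists_sum_sq_equiv {r s : ℝ} (hr : 0 < r) (hrs : r < s) (hs : s < 2) :
    ∃ c > 0, ∃ C > 0, ∀ m : ℕ, ∃ (N : ℕ) (w : (Fin m → Fin N) → ℝ) (h : Fin N → ℝ),
      (∀ k, 0 ≤ w k) ∧ ∀ a : Fin m → ℝ, ∑ j, |a j| ^ s = 1 →
        c ≤ ∑ k, w k * (∑ j, (h (k j) * a j) ^ 2) ^ (r / 2) ∧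
        ∑ k, w k * (∑ j, (h (k j) * a j) ^ 2) ^ (r / 2) ≤ C := by
  classical
  have hs0 : 0 < s := hr.trans hrs
  obtain ⟨A, hA, B, hB, H⟩ := exists_dyadic_pareto hr hrs hs
  refine ⟨1 - Real.exp (-(B / 2)), by simpa using hB, 1 + A, by positivity, fun m => ?_⟩
  obtain ⟨L, hL⟩ := pow_unbounded_of_one_lt ((2 * m + 1 : ℝ) ^ (1 / s))
    (show (1 : ℝ) < 2 by norm_num)
  obtain ⟨p, hp0, hp1, hup, hlow⟩ := H L
  have hw0 : ∀ k : Fin m → Fin (L + 1), 0 ≤ ∏ i, p (k i) :=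
    fun k => Finset.prod_nonneg fun i _ => hp0 _
  have hw1 : ∑ k : Fin m → Fin (L + 1), ∏ i, p (k i) = 1 := by
    have h := Finset.prod_univ_sum (fun _ : Fin m => (Finset.univ : Finset (Fin (L + 1))))
      (fun _ l => p l)
    simpa [hp1] using h.symm
  refine ⟨L + 1, fun k => ∏ i, p (k i), fun l => 2 ^ (l : ℕ), hw0, fun a ha => ?_⟩
  have ha1 : ∀ j, |a j| ≤ 1 := fun j => by
    have : |a j| ^ s ≤ 1 := by
      rw [← ha]
      exact Finset.single_le_sum (f := fun j => |a j| ^ s) (fun i _ => by positivity)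
        (Finset.mem_univ j)
    by_contra! hlt
    exact absurd (Real.one_lt_rpow hlt hs0) this.not_gt
  constructor
  · have hq : ∀ j, ∑ l : Fin (L + 1), (if 1 ≤ 2 ^ (l : ℕ) * |a j| then 0 else p l) ≤
        Real.exp (-(B * (|a j| ^ s - 1 / (2 * m)))) := by
      intro j
      have hm : (0 : ℝ) < m := by exact_mod_cast (Nat.zero_le _).trans_lt j.2
      have hsplit : ∑ l : Fin (L + 1), (if 1 ≤ 2 ^ (l : ℕ) * |a j| then 0 else p l) =
          1 - ∑ l : Fin (L + 1), (if 1 ≤ 2 ^ (l : ℕ) * |a j| then p l else 0) := by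
        rw [← hp1, ← Finset.sum_sub_distrib]
        refine Finset.sum_congr rfl fun l _ => ?_
        split_ifs <;> simp
      have hE := Real.add_one_le_exp (-(B * (|a j| ^ s - 1 / (2 * m))))
      rw [hsplit]
      by_cases hj : |a j| ^ s ≤ 1 / (2 * m)
      · have h1 : 0 ≤ ∑ l : Fin (L + 1), (if 1 ≤ 2 ^ (l : ℕ) * |a j| then p l else 0) :=
          Finset.sum_nonneg fun l _ => by split_ifs <;> simp [hp0]
        have : 0 ≤ B * (1 / (2 * m) - |a j| ^ s) := mul_nonneg hB.le (by linarith)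
        linarith
      · push Not at hj
        have hpos : 0 < |a j| := by
          rcases (abs_nonneg (a j)).eq_or_lt with h | h
          · rw [← h, Real.zero_rpow hs0.ne'] at hj
            have : (0 : ℝ) < 1 / (2 * m) := by positivity
            linarith
          · exact h
        have h1 := hlow |a j| hpos (ha1 j) (by
          have h3 : (1 : ℝ) ≤ (2 * m + 1) ^ (1 / s) * |a j| := by
            have : ((1 : ℝ) ^ (1 / s)) ≤ ((2 * m + 1) * |a j| ^ s) ^ (1 / s) := by
              refine Real.rpow_le_rpow zero_le_one ?_ (by positivity)
              rw [div_lt_iff₀ (by positivity)] at hj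
              have : 0 ≤ |a j| ^ s := by positivity
              linarith
            rwa [Real.one_rpow, Real.mul_rpow (by positivity) (by positivity),
              ← Real.rpow_mul hpos.le, mul_one_div_cancel hs0.ne', Real.rpow_one] at this
          exact h3.trans (mul_le_mul_of_nonneg_right hL.le hpos.le))
        have : 0 ≤ B * (1 / (2 * m)) := by positivity
        linarith
    have hbad : ∑ k : Fin m → Fin (L + 1), ∏ j, (if 1 ≤ 2 ^ (k j : ℕ) * |a j| then 0 else p (k j))
        ≤ Real.exp (-(B / 2)) := by
      have h := Finset.prod_univ_sum (fun _ : Fin m => (Finset.univ : Finset (Fin (L + 1))))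
        (fun j l => if 1 ≤ 2 ^ (l : ℕ) * |a j| then 0 else p l)
      rw [Fintype.piFinset_univ] at h
      rw [← h]
      refine (Finset.prod_le_prod (fun j _ => Finset.sum_nonneg fun l _ => ?_)
        fun j _ => hq j).trans ?_
      · split_ifs <;> simp [hp0]
      · rw [← Real.exp_sum]
        refine Real.exp_le_exp.2 ?_
        rw [Finset.sum_neg_distrib, ← Finset.mul_sum, Finset.sum_sub_distrib, ha]
        have : ∑ j : Fin m, (1 : ℝ) / (2 * m) ≤ 1 / 2 := by
          rcases Nat.eq_zero_or_pos m with h | h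
          · subst h; simp
          · have : (0 : ℝ) < m := by exact_mod_cast h
            simp; field_simp; exact le_refl _
        nlinarith
    have hmain : ∑ k : Fin m → Fin (L + 1), (∏ i, p (k i) -
        ∏ j, (if 1 ≤ 2 ^ (k j : ℕ) * |a j| then 0 else p (k j))) ≤
        ∑ k : Fin m → Fin (L + 1), (∏ i, p (k i)) *
          (∑ j, (2 ^ (k j : ℕ) * a j) ^ 2) ^ (r / 2) := by
      refine Finset.sum_le_sum fun k _ => ?_
      by_cases hk : ∃ j, 1 ≤ 2 ^ (k j : ℕ) * |a j|
      · obtain ⟨j, hj⟩ := hk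
        have hz : ∏ j, (if 1 ≤ 2 ^ (k j : ℕ) * |a j| then 0 else p (k j)) = 0 :=
          Finset.prod_eq_zero (Finset.mem_univ j) (if_pos hj)
        rw [hz, sub_zero]
        refine le_mul_of_one_le_right (hw0 k) (Real.one_le_rpow ?_ (by positivity))
        refine le_trans ?_ (Finset.single_le_sum (f := fun j => (2 ^ (k j : ℕ) * a j) ^ 2)
          (fun i _ => sq_nonneg _) (Finset.mem_univ j))
        rw [← sq_abs, abs_mul, abs_of_pos (show (0 : ℝ) < 2 ^ (k j : ℕ) by positivity)]
        exact one_le_pow₀ hj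
      · push Not at hk
        rw [Finset.prod_congr rfl fun j _ => if_neg (hk j).not_ge, sub_self]
        exact mul_nonneg (hw0 k) (Real.rpow_nonneg (Finset.sum_nonneg fun _ _ => sq_nonneg _) _)
    rw [Finset.sum_sub_distrib, hw1] at hmain
    linarith
  · have hpt : ∀ k : Fin m → Fin (L + 1), (∑ j, (2 ^ (k j : ℕ) * a j) ^ 2) ^ (r / 2) ≤
        1 + ∑ j, (if 2 ^ (k j : ℕ) * |a j| ≤ 1 then (2 ^ (k j : ℕ) * |a j|) ^ 2
          else (2 ^ (k j : ℕ) * |a j|) ^ r) := by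
      intro k
      set y : Fin m → ℝ := fun j => 2 ^ (k j : ℕ) * |a j| with hy
      have hy0 : ∀ j, 0 ≤ y j := fun j => by positivity
      have hsq : ∑ j, (2 ^ (k j : ℕ) * a j) ^ 2 =
          ∑ j, (if y j ≤ 1 then y j ^ 2 else 0) + ∑ j, (if y j ≤ 1 then 0 else y j ^ 2) := by
        rw [← Finset.sum_add_distrib]
        refine Finset.sum_congr rfl fun j _ => ?_
        have : (2 ^ (k j : ℕ) * a j) ^ 2 = y j ^ 2 := by rw [hy]; simp [mul_pow]
        rw [this]; split_ifs <;> simp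
      have h1 : 0 ≤ ∑ j, (if y j ≤ 1 then y j ^ 2 else 0) :=
        Finset.sum_nonneg fun j _ => by split_ifs <;> positivity
      have h2 : ∀ j ∈ Finset.univ, 0 ≤ (if y j ≤ 1 then 0 else y j ^ 2) :=
        fun j _ => by split_ifs <;> positivity
      rw [hsq]
      refine (Real.rpow_add_le_add_rpow h1 (Finset.sum_nonneg h2) (by positivity)
        (by linarith)).trans ?_
      have h3 : (∑ j, (if y j ≤ 1 then y j ^ 2 else 0)) ^ (r / 2) ≤
          1 + ∑ j, (if y j ≤ 1 then y j ^ 2 else 0) := by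
        rcases le_or_gt (∑ j, (if y j ≤ 1 then y j ^ 2 else 0)) 1 with h | h
        · have := Real.rpow_le_one h1 h (show 0 ≤ r / 2 by positivity)
          linarith
        · have := Real.rpow_le_rpow_of_exponent_le h.le (show r / 2 ≤ 1 by linarith)
          rw [Real.rpow_one] at this
          linarith
      have h4 := Real.rpow_sum_le_sum_rpow Finset.univ _ h2 (show 0 < r / 2 by positivity)
        (by linarith)
      refine (add_le_add h3 h4).trans_eq ?_
      rw [add_assoc, ← Finset.sum_add_distrib]
      congr 1
      refine Finset.sum_congr rfl fun j _ => ?_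
      split_ifs
      · rw [Real.zero_rpow (by positivity), add_zero]
      · rw [zero_add, ← Real.rpow_natCast, ← Real.rpow_mul (hy0 j)]
        congr 1; push_cast; ring
    refine (Finset.sum_le_sum fun k _ => mul_le_mul_of_nonneg_left (hpt k) (hw0 k)).trans ?_
    simp only [mul_add, mul_one, Finset.sum_add_distrib, hw1, Finset.mul_sum]
    rw [Finset.sum_comm]
    gcongr
    calc _ ≤ ∑ j, A * |a j| ^ s := by
          refine Finset.sum_le_sum fun j _ => ?_
          rw [sum_prod_weights_mul p hp1 (fun l => if 2 ^ (l : ℕ) * |a j| ≤ 1 then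
            (2 ^ (l : ℕ) * |a j|) ^ 2 else (2 ^ (l : ℕ) * |a j|) ^ r) j]
          exact hup _ (abs_nonneg _) (ha1 j)
      _ = A := by rw [← Finset.mul_sum, ha, mul_one]

/-- To estimate a discrete `r`-th moment of a linear form by the `ℓ^s` norm of its coefficients, it
suffices to do so on the unit sphere. -/
theorem equiv_of_sphere {κ : Type*} [Fintype κ] {r s c C : ℝ} (hr : 0 < r) (hs : 0 < s) {m : ℕ}
    (θ : κ → Fin m → ℝ)
    (H : ∀ a : Fin m → ℝ, ∑ j, |a j| ^ s = 1 →
      c ≤ ∑ k, |∑ j, θ k j * a j| ^ r ∧ ∑ k, |∑ j, θ k j * a j| ^ r ≤ C) (a : Fin m → ℝ) :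
    c * (∑ j, |a j| ^ s) ^ (r / s) ≤ ∑ k, |∑ j, θ k j * a j| ^ r ∧
      ∑ k, |∑ j, θ k j * a j| ^ r ≤ C * (∑ j, |a j| ^ s) ^ (r / s) := by
  have hn : 0 ≤ ∑ j, |a j| ^ s := Finset.sum_nonneg fun _ _ => by positivity
  rcases hn.eq_or_lt with h | h
  · have ha : ∀ j, a j = 0 := fun j => by
      have := (Finset.sum_eq_zero_iff_of_nonneg fun j _ =>
        Real.rpow_nonneg (abs_nonneg (a j)) s).1 h.symm j (Finset.mem_univ _)
      simpa [Real.rpow_eq_zero (abs_nonneg (a j)) hs.ne'] using this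
    have hrs : r / s ≠ 0 := by positivity
    simp [ha, hr.ne', hs.ne', hrs]
  · set σ := (∑ j, |a j| ^ s) ^ (1 / s) with hσ
    have hσ0 : 0 < σ := by positivity
    have hσs : ∑ j, |a j| ^ s = σ ^ s := by
      rw [hσ, ← Real.rpow_mul hn, one_div_mul_cancel hs.ne', Real.rpow_one]
    have hk := H (fun j => a j / σ) (by
      simp only [abs_div, abs_of_pos hσ0, Real.div_rpow (abs_nonneg _) hσ0.le, ← Finset.sum_div,
        hσs]
      exact div_self (by positivity))
    have e1 : ∀ k, |∑ j, θ k j * (a j / σ)| ^ r = |∑ j, θ k j * a j| ^ r / σ ^ r := fun e => by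
      simp only [← mul_div_assoc, ← Finset.sum_div]
      rw [abs_div, abs_of_pos hσ0, Real.div_rpow (abs_nonneg _) hσ0.le]
    have hs : (∑ j, |a j| ^ s) ^ (r / s) = σ ^ r := by
      rw [hσs, ← Real.rpow_mul hσ0.le, mul_div_cancel₀ _ hs.ne']
    have hp : 0 < σ ^ r := by positivity
    simp only [e1, ← Finset.sum_div] at hk
    rw [le_div_iff₀ hp, div_le_iff₀ hp] at hk
    rw [hs]
    exact hk

/-- For `0 < r ≤ s ≤ 2` the spaces `ℓ^s_m` embed into `ℓ^r_N` with constants independent of `m`. -/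
theorem exists_lp_embedding {r s : ℝ} (hr : 0 < r) (hrs : r ≤ s) (hs : s ≤ 2) :
    ∃ c > 0, ∃ C > 0, ∀ m : ℕ, ∃ (N : ℕ) (θ : Fin N → Fin m → ℝ), ∀ a : Fin m → ℝ,
      c * (∑ j, |a j| ^ s) ^ (r / s) ≤ ∑ k, |∑ j, θ k j * a j| ^ r ∧
      ∑ k, |∑ j, θ k j * a j| ^ r ≤ C * (∑ j, |a j| ^ s) ^ (r / s) := by
  have hs0 : 0 < s := hr.trans_le hrs
  suffices h : ∃ c > 0, ∃ C > 0, ∀ m : ℕ, ∃ (κ : Type) (_ : Fintype κ) (θ : κ → Fin m → ℝ),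
      ∀ a : Fin m → ℝ, ∑ j, |a j| ^ s = 1 →
        c ≤ ∑ k, |∑ j, θ k j * a j| ^ r ∧ ∑ k, |∑ j, θ k j * a j| ^ r ≤ C by
    obtain ⟨c, hc, C, hC, H⟩ := h
    refine ⟨c, hc, C, hC, fun m => ?_⟩
    obtain ⟨κ, _, θ, hθ⟩ := H m
    refine ⟨Fintype.card κ, fun k => θ ((Fintype.equivFin κ).symm k),
      equiv_of_sphere hr hs0 _ fun a ha => ?_⟩
    rw [(Fintype.equivFin κ).symm.sum_comp fun k => |∑ j, θ k j * a j| ^ r]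
    exact hθ a ha
  rcases hrs.eq_or_lt with rfl | hrs
  · refine ⟨1, one_pos, 1, one_pos, fun m => ⟨Fin m, inferInstance,
      fun k j => if k = j then 1 else 0, fun a ha => ?_⟩⟩
    simp [ha]
  rcases hs.eq_or_lt with rfl | hs
  · refine ⟨1 / 12, by norm_num, 2, by norm_num, fun m => ⟨Fin m → Bool, inferInstance,
      fun e j => ((2 ^ m)⁻¹ : ℝ) ^ (1 / r) * boolSign (e j), fun a ha => ?_⟩⟩
    have hk := khintchine_of_sum_sq_eq_one hr hrs.le m a (by simpa using ha)
    have h2 : (0 : ℝ) < 2 ^ m := by positivity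
    simp only [mul_assoc, ← Finset.mul_sum, abs_mul,
      abs_of_pos (show 0 < ((2 ^ m)⁻¹ : ℝ) ^ (1 / r) by positivity)]
    simp only [Real.mul_rpow (show 0 ≤ ((2 ^ m)⁻¹ : ℝ) ^ (1 / r) by positivity) (abs_nonneg _),
      ← Finset.mul_sum]
    rw [← Real.rpow_mul (by positivity), one_div_mul_cancel hr.ne', Real.rpow_one,
      inv_mul_eq_div, le_div_iff₀ h2, div_le_iff₀ h2]
    exact ⟨by linarith [hk.1], by linarith [hk.2]⟩
  · obtain ⟨c, hc, C, hC, H⟩ := exists_sum_sq_equiv hr hrs hs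
    refine ⟨c / 12, by positivity, 2 * C, by positivity, fun m => ?_⟩
    obtain ⟨N, w, h, hw, H⟩ := H m
    refine ⟨(Fin m → Fin N) × (Fin m → Bool), inferInstance,
      fun k j => (w k.1 / 2 ^ m) ^ (1 / r) * (boolSign (k.2 j) * h (k.1 j)), fun a ha => ?_⟩
    have hH := H a ha
    have hw' : ∀ k, 0 ≤ w k / 2 ^ m := fun k => div_nonneg (hw k) (by positivity)
    have e : ∀ k : Fin m → Fin N, ∑ e : Fin m → Bool,
        |∑ j, (w k / 2 ^ m) ^ (1 / r) * (boolSign (e j) * h (k j)) * a j| ^ r =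
        w k / 2 ^ m * ∑ e : Fin m → Bool, |∑ j, boolSign (e j) * (h (k j) * a j)| ^ r := by
      intro k
      rw [Finset.mul_sum]
      refine Finset.sum_congr rfl fun e _ => ?_
      simp only [mul_assoc, ← Finset.mul_sum]
      rw [abs_mul, Real.mul_rpow (abs_nonneg _) (abs_nonneg _),
        abs_of_nonneg (Real.rpow_nonneg (hw' k) _), ← Real.rpow_mul (hw' k),
        one_div_mul_cancel hr.ne', Real.rpow_one]
    rw [Fintype.sum_prod_type]
    simp only [e]
    have hk := fun k : Fin m → Fin N => khintchine hr (hrs.trans hs).le m fun j => h (k j) * a j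
    constructor
    · calc c / 12 ≤ 1 / 12 * ∑ k, w k * (∑ j, (h (k j) * a j) ^ 2) ^ (r / 2) := by linarith [hH.1]
        _ = ∑ k, w k / 2 ^ m * (2 ^ m / 12 * (∑ j, (h (k j) * a j) ^ 2) ^ (r / 2)) := by
          rw [Finset.mul_sum]
          refine Finset.sum_congr rfl fun k _ => ?_
          field_simp
        _ ≤ _ := Finset.sum_le_sum fun k _ => mul_le_mul_of_nonneg_left (hk k).1 (hw' k)
    · calc _ ≤ ∑ k, w k / 2 ^ m * (2 ^ m * 2 * (∑ j, (h (k j) * a j) ^ 2) ^ (r / 2)) :=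
          Finset.sum_le_sum fun k _ => mul_le_mul_of_nonneg_left (hk k).2 (hw' k)
        _ = 2 * ∑ k, w k * (∑ j, (h (k j) * a j) ^ 2) ^ (r / 2) := by
          rw [Finset.mul_sum]
          refine Finset.sum_congr rfl fun k _ => ?_
          field_simp
        _ ≤ _ := by linarith [hH.2]

/-- The real version of the dual description of the `ℓ^p` norm: the supremum is attained. -/
theorem exists_inner_eq_rpow_sum {ι : Type*} [Fintype ι] {p q : ℝ} (hpq : p.HolderConjugate q)
    (f : ι → ℝ) : ∃ g : ι → ℝ, ∑ i, |g i| ^ q ≤ 1 ∧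
      ∑ i, f i * g i = (∑ i, |f i| ^ p) ^ (1 / p) := by
  obtain ⟨g, hg, hfg⟩ := (NNReal.isGreatest_Lp Finset.univ (fun i => Real.nnabs (f i)) hpq).1
  refine ⟨fun i => SignType.sign (f i) * g i, ?_, ?_⟩
  · have hg' : ∑ i, (g i : ℝ) ^ q ≤ 1 := by exact_mod_cast hg
    refine (Finset.sum_le_sum fun i _ => ?_).trans hg'
    refine Real.rpow_le_rpow (abs_nonneg _) ?_ hpq.symm.nonneg
    rw [abs_mul, NNReal.abs_eq]
    refine mul_le_of_le_one_left (g i).2 ?_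
    rcases lt_trichotomy (f i) 0 with h | h | h <;> simp [h]
  · have := congrArg (fun x : NNReal => (x : ℝ)) hfg
    push_cast at this
    rw [← this]
    refine Finset.sum_congr rfl fun i _ => ?_
    rw [← mul_assoc, self_mul_sign]

/-- Dual form of `exists_lp_embedding`: for `2 ≤ s ≤ r` the spaces `ℓ^s_m` are quotients of
`ℓ^r_N` with constants independent of `m`. -/
theorem exists_lp_quotient {r s : ℝ} (hs : 2 ≤ s) (hsr : s ≤ r) :
    ∃ C > 0, ∀ m : ℕ, ∃ (N : ℕ) (θ : Fin N → Fin m → ℝ),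
      (∀ g : Fin N → ℝ, (∑ j, |∑ k, θ k j * g k| ^ s) ^ (1 / s) ≤
        C * (∑ k, |g k| ^ r) ^ (1 / r)) ∧
      ∀ a : Fin m → ℝ, ∃ f : Fin N → ℝ, (∀ j, ∑ k, θ k j * f k = a j) ∧
        (∑ k, |f k| ^ r) ^ (1 / r) ≤ C * (∑ j, |a j| ^ s) ^ (1 / s) := by
  have hsσ : s.HolderConjugate s.conjExponent := .conjExponent (by linarith)
  have hrρ : r.HolderConjugate r.conjExponent := .conjExponent (by linarith)
  set σ := s.conjExponent with hσ
  set ρ := r.conjExponent with hρ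
  have hρσ : ρ ≤ σ := by
    rw [hrρ.conjugate_eq, hsσ.conjugate_eq, div_le_div_iff₀ (by linarith) (by linarith)]
    nlinarith
  have hσ2 : σ ≤ 2 := by
    rw [hsσ.conjugate_eq, div_le_iff₀ (by linarith)]
    linarith
  have hρ0 : 0 < ρ := hrρ.symm.pos
  have hσ0 : 0 < σ := hsσ.symm.pos
  obtain ⟨c, hc, C, hC, H⟩ := exists_lp_embedding hρ0 hρσ hσ2
  refine ⟨max (C ^ (1 / ρ)) ((c ^ (1 / ρ))⁻¹), lt_max_of_lt_left (by positivity), fun m => ?_⟩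
  obtain ⟨N, θ, hθ⟩ := H m
  have hroot : ∀ a : Fin m → ℝ, ((∑ j, |a j| ^ σ) ^ (ρ / σ)) ^ (1 / ρ) =
      (∑ j, |a j| ^ σ) ^ (1 / σ) := fun a => by
    rw [← Real.rpow_mul (Finset.sum_nonneg fun _ _ => by positivity)]
    congr 1; field_simp
  have hup : ∀ a : Fin m → ℝ, (∑ k, |∑ j, θ k j * a j| ^ ρ) ^ (1 / ρ) ≤
      C ^ (1 / ρ) * (∑ j, |a j| ^ σ) ^ (1 / σ) := fun a => by
    rw [← hroot, ← Real.mul_rpow hC.le (by positivity)]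
    exact Real.rpow_le_rpow (by positivity) (hθ a).2 (by positivity)
  have hlow : ∀ a : Fin m → ℝ, (∑ j, |a j| ^ σ) ^ (1 / σ) ≤
      (c ^ (1 / ρ))⁻¹ * (∑ k, |∑ j, θ k j * a j| ^ ρ) ^ (1 / ρ) := fun a => by
    rw [inv_mul_eq_div, le_div_iff₀ (by positivity), mul_comm, ← hroot,
      ← Real.mul_rpow hc.le (by positivity)]
    exact Real.rpow_le_rpow (by positivity) (hθ a).1 (by positivity)
  refine ⟨N, θ, fun g => ?_, fun a => ?_⟩
  · obtain ⟨b, hb, hgb⟩ := exists_inner_eq_rpow_sum hsσ fun j => ∑ k, θ k j * g k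
    rw [← hgb]
    calc ∑ j, (∑ k, θ k j * g k) * b j = ∑ k, g k * ∑ j, θ k j * b j := by
          simp only [Finset.sum_mul, Finset.mul_sum]
          rw [Finset.sum_comm]
          exact Finset.sum_congr rfl fun _ _ => Finset.sum_congr rfl fun _ _ => by ring
      _ ≤ (∑ k, |g k| ^ r) ^ (1 / r) * (∑ k, |∑ j, θ k j * b j| ^ ρ) ^ (1 / ρ) :=
          Real.inner_le_Lp_mul_Lq _ _ _ hrρ
      _ ≤ (∑ k, |g k| ^ r) ^ (1 / r) * C ^ (1 / ρ) := by
          refine mul_le_mul_of_nonneg_left ((hup b).trans ?_) (by positivity)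
          exact mul_le_of_le_one_right (by positivity)
            (Real.rpow_le_one (by positivity) hb (by positivity))
      _ ≤ _ := by
          rw [mul_comm]
          exact mul_le_mul_of_nonneg_right (le_max_left _ _) (by positivity)
  · set M := (c ^ (1 / ρ))⁻¹ * (∑ j, |a j| ^ s) ^ (1 / s) with hM
    have hM0 : 0 ≤ M := by positivity
    let J : (Fin m → ℝ) →ₗ[ℝ] (Fin N → ℝ) := Matrix.mulVecLin (Matrix.of θ)
    have hJ : ∀ b k, J b k = ∑ j, θ k j * b j := fun b k => rfl
    have hinj : Function.Injective J := by
      rw [← LinearMap.ker_eq_bot, LinearMap.ker_eq_bot']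
      intro b hb
      have h := hlow b
      simp only [← hJ, hb] at h
      simp only [Pi.zero_apply, abs_zero, Real.zero_rpow hρ0.ne', Finset.sum_const_zero,
        Real.zero_rpow (one_div_pos.2 hρ0).ne', mul_zero] at h
      have h0 : ∑ j, |b j| ^ σ = 0 := by
        have h1 : 0 ≤ ∑ j, |b j| ^ σ := by positivity
        exact ((Real.rpow_eq_zero h1 (one_div_pos.2 hσ0).ne').1 (h.antisymm (by positivity)))
      funext j
      have := (Finset.sum_eq_zero_iff_of_nonneg fun j _ =>
        Real.rpow_nonneg (abs_nonneg (b j)) σ).1 h0 j (Finset.mem_univ _)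
      simpa [Real.rpow_eq_zero (abs_nonneg (b j)) hσ0.ne'] using this
    let E := LinearEquiv.ofInjective J hinj
    let ℓ : (Fin m → ℝ) →ₗ[ℝ] ℝ := ∑ j, a j • LinearMap.proj j
    have hℓ : ∀ b, ℓ b = ∑ j, a j * b j := fun b => by simp [ℓ]
    obtain ⟨F, hF1, hF2⟩ := exists_extension_of_le_sublinear
      (⟨LinearMap.range J, ℓ ∘ₗ E.symm.toLinearMap⟩ : (Fin N → ℝ) →ₗ.[ℝ] ℝ)
      (fun g => M * (∑ k, |g k| ^ ρ) ^ (1 / ρ))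
      (fun t ht g => by
        have : ∑ k, |(t • g) k| ^ ρ = t ^ ρ * ∑ k, |g k| ^ ρ := by
          simp only [Pi.smul_apply, smul_eq_mul, abs_mul, abs_of_pos ht,
            Real.mul_rpow ht.le (abs_nonneg _), ← Finset.mul_sum]
        rw [this, Real.mul_rpow (by positivity) (by positivity), ← Real.rpow_mul ht.le,
          mul_one_div_cancel hρ0.ne', Real.rpow_one]
        ring)
      (fun g g' => by
        rw [← mul_add]
        exact mul_le_mul_of_nonneg_left (Real.Lp_add_le _ _ _ hrρ.symm.lt.le) hM0)
      (by
        rintro ⟨_, b, rfl⟩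
        have hEb : E.symm ⟨J b, b, rfl⟩ = b := by
          rw [LinearEquiv.symm_apply_eq]; rfl
        change ℓ (E.symm ⟨J b, b, rfl⟩) ≤ M * (∑ k, |J b k| ^ ρ) ^ (1 / ρ)
        rw [hEb, hℓ]
        refine (Real.inner_le_Lp_mul_Lq _ _ _ hsσ).trans ?_
        rw [hM, mul_comm (c ^ (1 / ρ))⁻¹, mul_assoc]
        exact mul_le_mul_of_nonneg_left (hlow b) (by positivity))
    have hFJ : ∀ b, F (J b) = ∑ j, a j * b j := fun b => by
      have h := hF1 ⟨J b, b, rfl⟩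
      have hEb : E.symm ⟨J b, b, rfl⟩ = b := by
        rw [LinearEquiv.symm_apply_eq]; rfl
      rw [← hℓ, ← hEb]
      simpa [hEb] using h
    have hFs : ∀ g : Fin N → ℝ, F g = ∑ k, g k * F (Pi.single k 1) := fun g => by
      conv_lhs => rw [pi_eq_sum_univ' g]
      simp
    refine ⟨fun k => F (Pi.single k 1), fun j => ?_, ?_⟩
    · have h := hFJ (Pi.single j 1)
      rw [hFs] at h
      simpa [hJ, Pi.single_apply] using h
    · obtain ⟨g, hg, hfg⟩ := exists_inner_eq_rpow_sum hrρ fun k => F (Pi.single k 1)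
      rw [← hfg]
      calc _ = F g := by rw [hFs]; exact Finset.sum_congr rfl fun _ _ => mul_comm _ _
        _ ≤ M * (∑ k, |g k| ^ ρ) ^ (1 / ρ) := hF2 g
        _ ≤ M := mul_le_of_le_one_right hM0
            (Real.rpow_le_one (by positivity) hg (by positivity))
        _ ≤ _ := mul_le_mul_of_nonneg_right (le_max_right _ _) (by positivity)

/-- The norm of `ℓ^r(ℓ^s)`. -/
noncomputable def mixedNorm {ι κ : Type*} [Fintype ι] [Fintype κ] (r s : ℝ) (z : ι → κ → ℝ) : ℝ :=
  (∑ i, (∑ j, |z i j| ^ s) ^ (r / s)) ^ (1 / r)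

section MixedNorm

variable {ι κ : Type*} [Fintype ι] [Fintype κ] {r s : ℝ}

theorem mixedNorm_nonneg (z : ι → κ → ℝ) : 0 ≤ mixedNorm r s z := by
  unfold mixedNorm; positivity

theorem mixedNorm_eq (z : ι → κ → ℝ) :
    mixedNorm r s z = (∑ i, |(∑ j, |z i j| ^ s) ^ (1 / s)| ^ r) ^ (1 / r) := by
  unfold mixedNorm
  congr 1
  refine Finset.sum_congr rfl fun i _ => ?_
  have h : 0 ≤ ∑ j, |z i j| ^ s := by positivity
  rw [abs_of_nonneg (by positivity), ← Real.rpow_mul h]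
  congr 1; ring

theorem mixedNorm_mono_inner {κ' : Type*} [Fintype κ'] {s' C : ℝ} (hC : 0 ≤ C) (hr : 0 < r)
    {z : ι → κ → ℝ} {z' : ι → κ' → ℝ}
    (h : ∀ i, (∑ j, |z i j| ^ s) ^ (1 / s) ≤ C * (∑ j, |z' i j| ^ s') ^ (1 / s')) :
    mixedNorm r s z ≤ C * mixedNorm r s' z' := by
  have hle : ∑ i, |(∑ j, |z i j| ^ s) ^ (1 / s)| ^ r ≤
      C ^ r * ∑ i, |(∑ j, |z' i j| ^ s') ^ (1 / s')| ^ r := by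
    rw [Finset.mul_sum]
    refine Finset.sum_le_sum fun i _ => ?_
    have h0 : 0 ≤ (∑ j, |z i j| ^ s) ^ (1 / s) := by positivity
    have h0' : 0 ≤ (∑ j, |z' i j| ^ s') ^ (1 / s') := by positivity
    rw [abs_of_nonneg h0, abs_of_nonneg h0', ← Real.mul_rpow hC h0']
    exact Real.rpow_le_rpow h0 (h i) hr.le
  rw [mixedNorm_eq, mixedNorm_eq]
  refine (Real.rpow_le_rpow (by positivity) hle (by positivity)).trans_eq ?_
  rw [Real.mul_rpow (by positivity) (by positivity), ← Real.rpow_mul hC,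
    mul_one_div_cancel hr.ne', Real.rpow_one]

theorem mixedNorm_anti (hr : 0 < r) (hs : 0 < s) {s' : ℝ} (hss' : s ≤ s') (z : ι → κ → ℝ) :
    mixedNorm r s' z ≤ mixedNorm r s z := by
  have := mixedNorm_mono_inner (C := 1) zero_le_one hr (s := s') (s' := s) (z := z) (z' := z)
    fun i => by
      rw [one_mul]
      exact Real.rpow_sum_rpow_anti Finset.univ (fun j => |z i j|) (fun _ _ => abs_nonneg _) hs hss'
  rwa [one_mul] at this

theorem mixedNorm_add_le (hr : 1 ≤ r) (hs : 1 ≤ s) (z w : ι → κ → ℝ) :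
    mixedNorm r s (fun i j => z i j + w i j) ≤ mixedNorm r s z + mixedNorm r s w := by
  simp only [mixedNorm_eq]
  refine le_trans ?_ (Real.Lp_add_le _ _ _ hr)
  refine Real.rpow_le_rpow (by positivity) (Finset.sum_le_sum fun i _ => ?_) (by positivity)
  refine Real.rpow_le_rpow (abs_nonneg _) ?_ (by positivity)
  rw [abs_of_nonneg (by positivity), abs_of_nonneg (by positivity)]
  exact Real.Lp_add_le _ _ _ hs

theorem mixedNorm_le_sum (hr : 1 ≤ r) (hs : 1 ≤ s) (z : ι → κ → ℝ) :
    mixedNorm r s z ≤ ∑ i, ∑ j, |z i j| := by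
  rw [mixedNorm_eq]
  have h1 := Real.rpow_sum_rpow_anti Finset.univ (fun i => |(∑ j, |z i j| ^ s) ^ (1 / s)|)
    (fun _ _ => abs_nonneg _) one_pos hr
  simp only [Real.rpow_one, div_one] at h1
  refine h1.trans (Finset.sum_le_sum fun i _ => ?_)
  rw [abs_of_nonneg (by positivity)]
  simpa using Real.rpow_sum_rpow_anti Finset.univ (fun j => |z i j|) (fun _ _ => abs_nonneg _)
      one_pos hs

theorem mixedNorm_self (hr : 0 < r) (z : ι → κ → ℝ) :
    mixedNorm r r z = (∑ k : ι × κ, |z k.1 k.2| ^ r) ^ (1 / r) := by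
  simp [mixedNorm, div_self hr.ne', Fintype.sum_prod_type]

end MixedNorm

section Lp

variable {Ω Ω' : Type*} [MeasurableSpace Ω] [MeasurableSpace Ω'] {μ : Measure Ω} {ν : Measure Ω'}
  {u v : ℝ≥0∞}

theorem aestronglyMeasurable_mixedNorm {ι κ : Type*} [Fintype ι] [Fintype κ] {r s : ℝ}
    {f : ι → κ → Ω → ℝ} (hf : ∀ i j, AEStronglyMeasurable (f i j) μ) :
    AEStronglyMeasurable (fun ω => mixedNorm r s fun i j => f i j ω) μ := by
  have hf' : ∀ i j, AEMeasurable (f i j) μ := fun i j => (hf i j).aemeasurable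
  unfold mixedNorm
  refine AEMeasurable.aestronglyMeasurable ?_
  fun_prop

theorem coeFn_sum_smul {κ : Type*} [Fintype κ] (c : κ → ℝ) (f : κ → Lp ℝ u μ) :
    ⇑(∑ j, c j • f j) =ᵐ[μ] fun ω => ∑ j, c j * f j ω := by
  have h : ∀ᵐ ω ∂μ, ∀ j, (c j • f j : Lp ℝ u μ) ω = c j * f j ω :=
    ae_all_iff.2 fun j => Lp.coeFn_smul (c j) (f j)
  filter_upwards [Lp.coeFn_fun_finsetSum Finset.univ fun j => c j • f j, h] with ω h1 h2
  rw [h1]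
  exact Finset.sum_congr rfl fun j _ => h2 j

theorem eLpNorm_fun_sum_le {ι : Type*} {s : Finset ι} {f : ι → Ω → ℝ}
    (hf : ∀ i ∈ s, AEStronglyMeasurable (f i) μ) (hu : 1 ≤ u) :
    eLpNorm (fun ω => ∑ i ∈ s, f i ω) u μ ≤ ∑ i ∈ s, eLpNorm (f i) u μ := by
  simpa only [Finset.sum_fn] using eLpNorm_sum_le hf hu

theorem eLpNorm_sum_abs_le {ι κ : Type*} [Fintype ι] [Fintype κ] (hu : 1 ≤ u)
    (z : ι → κ → Lp ℝ u μ) :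
    eLpNorm (fun ω => ∑ i, ∑ j, |z i j ω|) u μ ≤ ∑ i, ∑ j, ‖z i j‖ₑ := by
  have hm : ∀ i j, AEStronglyMeasurable (fun ω => |z i j ω|) μ :=
    fun i j => (Lp.aestronglyMeasurable (z i j)).norm
  have he : ∀ i j, eLpNorm (fun ω => |z i j ω|) u μ = ‖z i j‖ₑ := fun i j => by
    rw [Lp.enorm_def]
    exact eLpNorm_norm (z i j)
  simp only [← he]
  refine (eLpNorm_fun_sum_le (fun i _ =>
    Finset.aestronglyMeasurable_fun_sum _ fun j _ => hm i j) hu).trans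
    (Finset.sum_le_sum fun i _ => ?_)
  exact eLpNorm_fun_sum_le (fun j _ => hm i j) hu

theorem eLpNorm_mixedNorm_le_add {ι κ : Type*} [Fintype ι] [Fintype κ] {r s : ℝ} (hr : 1 ≤ r)
    (hs : 1 ≤ s) (hu : 1 ≤ u) (x y : ι → κ → Lp ℝ u μ) :
    eLpNorm (fun ω => mixedNorm r s fun i j => x i j ω) u μ ≤
      eLpNorm (fun ω => mixedNorm r s fun i j => y i j ω) u μ + ∑ i, ∑ j, ‖x i j - y i j‖ₑ := by
  have hy := aestronglyMeasurable_mixedNorm (r := r) (s := s) fun i j =>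
    Lp.aestronglyMeasurable (y i j)
  have hm : AEStronglyMeasurable (fun ω => ∑ i, ∑ j, |(x i j - y i j) ω|) μ :=
    Finset.aestronglyMeasurable_fun_sum _ fun i _ =>
      Finset.aestronglyMeasurable_fun_sum _ fun j _ =>
        (Lp.aestronglyMeasurable (x i j - y i j)).norm
  calc _ ≤ eLpNorm (fun ω => mixedNorm r s (fun i j => y i j ω) +
        ∑ i, ∑ j, |(x i j - y i j) ω|) u μ := by
        refine eLpNorm_mono_ae_real ?_
        have h : ∀ᵐ ω ∂μ, ∀ i j, (x i j - y i j) ω = x i j ω - y i j ω :=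
          ae_all_iff.2 fun i => ae_all_iff.2 fun j => Lp.coeFn_sub _ _
        filter_upwards [h] with ω hω
        rw [Real.norm_of_nonneg (mixedNorm_nonneg _)]
        have h1 := mixedNorm_add_le hr hs (fun i j => y i j ω) (fun i j => (x i j - y i j) ω)
        have h2 := mixedNorm_le_sum hr hs (fun i j => (x i j - y i j) ω)
        have h3 : (fun i j => y i j ω + (x i j - y i j) ω) = fun i j => x i j ω := by
          funext i j; rw [hω]; ring
        rw [h3] at h1
        linarith
    _ ≤ eLpNorm (fun ω => mixedNorm r s (fun i j => y i j ω)) u μ +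
        eLpNorm (fun ω => ∑ i, ∑ j, |(x i j - y i j) ω|) u μ :=
        eLpNorm_add_le hy hm hu
    _ ≤ _ := add_le_add le_rfl (eLpNorm_sum_abs_le hu fun i j => x i j - y i j)

theorem IsPQRegular.fintype {T : Lp ℝ u μ → Lp ℝ v ν} {p q K : ℝ} (hT : IsPQRegular T p q K)
    {ι : Type*} [Fintype ι] (f : ι → Lp ℝ u μ) :
    eLpNorm (fun ω' => (∑ i, |T (f i) ω'| ^ p) ^ (1 / p)) v ν ≤
      ENNReal.ofReal K * eLpNorm (fun ω => (∑ i, |f i ω| ^ q) ^ (1 / q)) u μ := by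
  have h := hT (Fintype.card ι) fun k => f ((Fintype.equivFin ι).symm k)
  have e1 : ∀ ω', ∑ k, |T (f ((Fintype.equivFin ι).symm k)) ω'| ^ p = ∑ i, |T (f i) ω'| ^ p :=
    fun ω' => (Fintype.equivFin ι).symm.sum_comp fun i => |T (f i) ω'| ^ p
  have e2 : ∀ ω, ∑ k, |f ((Fintype.equivFin ι).symm k) ω| ^ q = ∑ i, |f i ω| ^ q :=
    fun ω => (Fintype.equivFin ι).symm.sum_comp fun i => |f i ω| ^ q
  simpa only [e1, e2] using h

theorem IsPQRegular.mixedNorm_self {T : Lp ℝ u μ → Lp ℝ v ν} {r K : ℝ} (hr : 0 < r)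
    (hT : IsPQRegular T r r K) {ι κ : Type*} [Fintype ι] [Fintype κ] (f : ι → κ → Lp ℝ u μ) :
    eLpNorm (fun ω' => mixedNorm r r fun i j => T (f i j) ω') v ν ≤
      ENNReal.ofReal K * eLpNorm (fun ω => mixedNorm r r fun i j => f i j ω) u μ := by
  simp only [_root_.mixedNorm_self hr]
  exact hT.fintype fun k : ι × κ => f k.1 k.2

/-- `(r,r)`-regular operators extend to `ℓ^r(ℓ^s)`-valued functions when `r ≤ s ≤ 2`. -/
theorem IsPQRegular.exists_mixedNorm_le_of_le_two {r s K : ℝ} (hr : 0 < r) (hrs : r ≤ s)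
    (hs : s ≤ 2) [Fact (1 ≤ u)] [Fact (1 ≤ v)] {T : Lp ℝ u μ →L[ℝ] Lp ℝ v ν}
    (hT : IsPQRegular T r r K) :
    ∃ K' : ℝ, ∀ (n m : ℕ) (x : Fin n → Fin m → Lp ℝ u μ),
      eLpNorm (fun ω' => mixedNorm r s fun i j => T (x i j) ω') v ν ≤
        ENNReal.ofReal K' * eLpNorm (fun ω => mixedNorm r s fun i j => x i j ω) u μ := by
  have hs0 : 0 < s := hr.trans_le hrs
  obtain ⟨c, hc, C, hC, H⟩ := exists_lp_embedding hr hrs hs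
  refine ⟨(c ^ (1 / r))⁻¹ * max K 0 * C ^ (1 / r), fun n m x => ?_⟩
  obtain ⟨N, θ, hθ⟩ := H m
  have hroot : ∀ a : Fin m → ℝ, ((∑ j, |a j| ^ s) ^ (r / s)) ^ (1 / r) =
      (∑ j, |a j| ^ s) ^ (1 / s) := fun a => by
    rw [← Real.rpow_mul (Finset.sum_nonneg fun _ _ => by positivity)]
    congr 1; field_simp
  have hup : ∀ a : Fin m → ℝ, (∑ k, |∑ j, θ k j * a j| ^ r) ^ (1 / r) ≤
      C ^ (1 / r) * (∑ j, |a j| ^ s) ^ (1 / s) := fun a => by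
    rw [← hroot, ← Real.mul_rpow hC.le (by positivity)]
    exact Real.rpow_le_rpow (by positivity) (hθ a).2 (by positivity)
  have hlow : ∀ a : Fin m → ℝ, (∑ j, |a j| ^ s) ^ (1 / s) ≤
      (c ^ (1 / r))⁻¹ * (∑ k, |∑ j, θ k j * a j| ^ r) ^ (1 / r) := fun a => by
    rw [inv_mul_eq_div, le_div_iff₀ (by positivity), mul_comm, ← hroot,
      ← Real.mul_rpow hc.le (by positivity)]
    exact Real.rpow_le_rpow (by positivity) (hθ a).1 (by positivity)
  set y : Fin n → Fin N → Lp ℝ u μ := fun i k => ∑ j, θ k j • x i j with hy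
  have hyx : ∀ᵐ ω ∂μ, ∀ i k, y i k ω = ∑ j, θ k j * x i j ω :=
    ae_all_iff.2 fun i => ae_all_iff.2 fun k => coeFn_sum_smul _ _
  have hTy : ∀ᵐ ω ∂ν, ∀ i k, T (y i k) ω = ∑ j, θ k j * T (x i j) ω := by
    refine ae_all_iff.2 fun i => ae_all_iff.2 fun k => ?_
    simp only [hy, map_sum, map_smul]
    exact coeFn_sum_smul (θ k) fun j => T (x i j)
  have h1 : eLpNorm (fun ω' => mixedNorm r s fun i j => T (x i j) ω') v ν ≤
      ENNReal.ofReal ((c ^ (1 / r))⁻¹) *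
        eLpNorm (fun ω' => mixedNorm r r fun i k => T (y i k) ω') v ν := by
    refine eLpNorm_le_mul_eLpNorm_of_ae_le_mul ?_ v
    filter_upwards [hTy] with ω hω
    rw [Real.norm_of_nonneg (mixedNorm_nonneg _), Real.norm_of_nonneg (mixedNorm_nonneg _)]
    refine mixedNorm_mono_inner (by positivity) hr fun i => ?_
    simp only [hω]
    exact hlow _
  have h2 : eLpNorm (fun ω => mixedNorm r r fun i k => y i k ω) u μ ≤
      ENNReal.ofReal (C ^ (1 / r)) *
        eLpNorm (fun ω => mixedNorm r s fun i j => x i j ω) u μ := by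
    refine eLpNorm_le_mul_eLpNorm_of_ae_le_mul ?_ u
    filter_upwards [hyx] with ω hω
    rw [Real.norm_of_nonneg (mixedNorm_nonneg _), Real.norm_of_nonneg (mixedNorm_nonneg _)]
    refine mixedNorm_mono_inner (by positivity) hr fun i => ?_
    simp only [hω]
    exact hup _
  have hK : ENNReal.ofReal K = ENNReal.ofReal (max K 0) := by simp [ENNReal.ofReal_max]
  rw [ENNReal.ofReal_mul (by positivity), ENNReal.ofReal_mul (by positivity), ← hK, mul_assoc,
    mul_assoc]
  exact h1.trans (mul_le_mul_right ((hT.mixedNorm_self hr y).trans (mul_le_mul_right h2 _)) _)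

/-- `(r,r)`-regular operators extend to `ℓ^r(ℓ^s)`-valued functions when `2 ≤ s ≤ r`. -/
theorem IsPQRegular.exists_mixedNorm_le_of_two_le {r s K : ℝ} (hs : 2 ≤ s) (hsr : s ≤ r)
    (hu : u ≠ ∞) [Fact (1 ≤ u)] [Fact (1 ≤ v)] {T : Lp ℝ u μ →L[ℝ] Lp ℝ v ν}
    (hT : IsPQRegular T r r K) :
    ∃ K' : ℝ, ∀ (n m : ℕ) (x : Fin n → Fin m → Lp ℝ u μ),
      eLpNorm (fun ω' => mixedNorm r s fun i j => T (x i j) ω') v ν ≤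
        ENNReal.ofReal K' * eLpNorm (fun ω => mixedNorm r s fun i j => x i j ω) u μ := by
  have hr : 0 < r := by linarith
  have hs1 : 1 ≤ s := by linarith
  obtain ⟨C, hC, H⟩ := exists_lp_quotient hs hsr
  refine ⟨C * max K 0 * C, fun n m x => ?_⟩
  obtain ⟨N, θ, hup, hlift⟩ := H m
  choose φ hφ hφC using hlift
  set K' : ℝ≥0∞ := ENNReal.ofReal (C * max K 0 * C) with hK'
  have hlifted : ∀ (g : Fin n → Fin m → Lp ℝ u μ) (y : Fin n → Fin N → Lp ℝ u μ),
      (∀ᵐ ω ∂μ, ∀ i k, y i k ω = φ (fun j => g i j ω) k) →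
      eLpNorm (fun ω' => mixedNorm r s fun i j => T (g i j) ω') v ν ≤
        K' * eLpNorm (fun ω => mixedNorm r s fun i j => g i j ω) u μ := by
    intro g y hyg
    have hgy : ∀ i j, g i j = ∑ k, θ k j • y i k := fun i j => by
      refine Lp.ext ?_
      filter_upwards [hyg, coeFn_sum_smul (fun k => θ k j) (y i)] with ω h1 h2
      simp only [h2, h1, hφ]
    have hTg : ∀ᵐ ω ∂ν, ∀ i j, T (g i j) ω = ∑ k, θ k j * T (y i k) ω := by
      refine ae_all_iff.2 fun i => ae_all_iff.2 fun j => ?_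
      simp only [hgy, map_sum, map_smul]
      exact coeFn_sum_smul (fun k => θ k j) fun k => T (y i k)
    have h1 : eLpNorm (fun ω' => mixedNorm r s fun i j => T (g i j) ω') v ν ≤
        ENNReal.ofReal C * eLpNorm (fun ω' => mixedNorm r r fun i k => T (y i k) ω') v ν := by
      refine eLpNorm_le_mul_eLpNorm_of_ae_le_mul ?_ v
      filter_upwards [hTg] with ω hω
      rw [Real.norm_of_nonneg (mixedNorm_nonneg _), Real.norm_of_nonneg (mixedNorm_nonneg _)]
      refine mixedNorm_mono_inner hC.le hr fun i => ?_
      simp only [hω]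
      exact hup _
    have h2 : eLpNorm (fun ω => mixedNorm r r fun i k => y i k ω) u μ ≤
        ENNReal.ofReal C * eLpNorm (fun ω => mixedNorm r s fun i j => g i j ω) u μ := by
      refine eLpNorm_le_mul_eLpNorm_of_ae_le_mul ?_ u
      filter_upwards [hyg] with ω hω
      rw [Real.norm_of_nonneg (mixedNorm_nonneg _), Real.norm_of_nonneg (mixedNorm_nonneg _)]
      refine mixedNorm_mono_inner hC.le hr fun i => ?_
      simp only [hω]
      exact hφC _
    have hK : ENNReal.ofReal K = ENNReal.ofReal (max K 0) := by simp [ENNReal.ofReal_max]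
    rw [hK', ENNReal.ofReal_mul (by positivity), ENNReal.ofReal_mul (by positivity), ← hK,
      mul_assoc, mul_assoc]
    exact h1.trans (mul_le_mul_right ((hT.mixedNorm_self hr y).trans (mul_le_mul_right h2 _)) _)
  have happrox : ∀ ε : ℝ≥0∞, ε ≠ 0 → ∃ g : Fin n → Fin m → Lp ℝ u μ,
      (∀ i j, ‖x i j - g i j‖ₑ ≤ ε) ∧
      eLpNorm (fun ω' => mixedNorm r s fun i j => T (g i j) ω') v ν ≤
        K' * eLpNorm (fun ω => mixedNorm r s fun i j => g i j ω) u μ := by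
    intro ε hε
    have hX : ∀ i, MemLp (fun ω j => x i j ω) u μ := fun i =>
      memLp_pi_iff.2 fun j => Lp.memLp (x i j)
    choose G hGε hG using fun i => (hX i).exists_simpleFunc_eLpNorm_sub_lt hu hε
    have hGj : ∀ i j, MemLp (fun ω => G i ω j) u μ := fun i j => memLp_pi_iff.1 (hG i) j
    have hφG : ∀ i k, MemLp (fun ω => φ (G i ω) k) u μ := fun i k => by
      have hsum : MemLp (fun ω => C * ∑ j, |G i ω j|) u μ :=
        (memLp_finsetSum _ fun j _ => (hGj i j).norm).const_mul C
      refine hsum.mono' ((G i).map fun a => φ a k).aestronglyMeasurable (ae_of_all _ fun ω => ?_)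
      have h1 := Real.rpow_sum_rpow_anti Finset.univ (fun j => |G i ω j|)
        (fun _ _ => abs_nonneg _) one_pos hs1
      have h2 : |φ (G i ω) k| ≤ (∑ k, |φ (G i ω) k| ^ r) ^ (1 / r) := by
        calc |φ (G i ω) k| = (|φ (G i ω) k| ^ r) ^ (1 / r) := by
              rw [← Real.rpow_mul (abs_nonneg _), mul_one_div_cancel hr.ne', Real.rpow_one]
          _ ≤ _ := Real.rpow_le_rpow (by positivity)
              (Finset.single_le_sum (f := fun k => |φ (G i ω) k| ^ r) (fun _ _ => by positivity)
                (Finset.mem_univ k)) (by positivity)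
      simp only [Real.rpow_one, div_one] at h1
      exact h2.trans ((hφC _).trans (mul_le_mul_of_nonneg_left h1 hC.le))
    refine ⟨fun i j => (hGj i j).toLp, fun i j => ?_,
      hlifted _ (fun i k => (hφG i k).toLp) ?_⟩
    · rw [Lp.enorm_def]
      refine le_trans (eLpNorm_mono_ae ?_) (hGε i).le
      filter_upwards [Lp.coeFn_sub (x i j) (hGj i j).toLp, (hGj i j).coeFn_toLp] with ω h1 h2
      rw [h1, Pi.sub_apply, h2]
      exact norm_le_pi_norm (((fun ω j => x i j ω) - ⇑(G i)) ω) j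
    · have h1 : ∀ᵐ ω ∂μ, ∀ i j, ((hGj i j).toLp : Lp ℝ u μ) ω = G i ω j :=
        ae_all_iff.2 fun i => ae_all_iff.2 fun j => (hGj i j).coeFn_toLp
      have h2 : ∀ᵐ ω ∂μ, ∀ i k, ((hφG i k).toLp : Lp ℝ u μ) ω = φ (G i ω) k :=
        ae_all_iff.2 fun i => ae_all_iff.2 fun k => (hφG i k).coeFn_toLp
      filter_upwards [h1, h2] with ω h1 h2 i k
      rw [h2]
      simp only [h1]
  set M : ℝ≥0∞ := K' * (n * m) + ‖T‖ₑ * (n * m) with hM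
  have hMtop : M ≠ ∞ := by
    have : ‖T‖ₑ ≠ ∞ := enorm_ne_top
    finiteness
  refine ENNReal.le_of_forall_pos_le_add fun ε hε _ => ?_
  obtain ⟨g, hg, hTg⟩ := happrox (ε / (M + 1)) (by
    simp only [ne_eq, ENNReal.div_eq_zero_iff, ENNReal.coe_eq_zero, not_or]
    exact ⟨hε.ne', by finiteness⟩)
  set δ : ℝ≥0∞ := ε / (M + 1) with hδ
  have hsum : ∀ (z : Fin n → Fin m → ℝ≥0∞) (B : ℝ≥0∞), (∀ i j, z i j ≤ B) →
      ∑ i, ∑ j, z i j ≤ n * m * B := fun z B hz => by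
    calc _ ≤ ∑ _i : Fin n, ∑ _j : Fin m, B :=
          Finset.sum_le_sum fun i _ => Finset.sum_le_sum fun j _ => hz i j
      _ = n * m * B := by simp [mul_assoc]
  have hTx := eLpNorm_mixedNorm_le_add (r := r) (by linarith) hs1 Fact.out
    (fun i j => T (x i j)) fun i j => T (g i j)
  have hgx := eLpNorm_mixedNorm_le_add (r := r) (by linarith) hs1 Fact.out g x
  have h1 : ∑ i, ∑ j, ‖T (x i j) - T (g i j)‖ₑ ≤ n * m * (‖T‖ₑ * δ) := hsum _ _ fun i j => by
    rw [← map_sub]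
    exact (T.le_opENorm _).trans (mul_le_mul_right (hg i j) _)
  have h2 : ∑ i, ∑ j, ‖g i j - x i j‖ₑ ≤ n * m * δ := hsum _ _ fun i j => by
    rw [← enorm_neg, neg_sub]
    exact hg i j
  calc _ ≤ K' * (eLpNorm (fun ω => mixedNorm r s fun i j => x i j ω) u μ + n * m * δ) +
        n * m * (‖T‖ₑ * δ) := by
        refine hTx.trans (add_le_add (hTg.trans (mul_le_mul_right ?_ _)) h1)
        exact hgx.trans (by gcongr)
    _ = K' * eLpNorm (fun ω => mixedNorm r s fun i j => x i j ω) u μ + M * δ := by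
        rw [hM]; ring
    _ ≤ _ := by
        gcongr
        calc M * δ ≤ (M + 1) * δ := by gcongr; exact le_self_add
          _ ≤ ε := ENNReal.mul_div_le

end Lp

/-- Characterization of `r`-regularity by matrix inequalities: if
`[q,p] ∩ [min{r,2}, max{r,2}] ≠ ∅`, an operator `T : L^a(μ) → L^b(ν)` is
`(r,r)`-regular iff the mixed-norm matrix inequality with exponents `p, q, r`
holds. -/
theorem stmt16 {Ω Ω' : Type*} [MeasurableSpace Ω] [MeasurableSpace Ω']
    (μ : Measure Ω) (ν : Measure Ω') [SigmaFinite μ] [SigmaFinite ν]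
    (r p q a b : ℝ) (hr : 1 < r) (hq : 1 ≤ q) (hqp : q ≤ p)
    (hint : ∃ t : ℝ, q ≤ t ∧ t ≤ p ∧ min r 2 ≤ t ∧ t ≤ max r 2)
    (hra : r ≤ a) (hb1 : 1 < b) (hbr : b ≤ r)
    [Fact (1 ≤ ENNReal.ofReal a)] [Fact (1 ≤ ENNReal.ofReal b)]
    (T : Lp ℝ (ENNReal.ofReal a) μ →L[ℝ] Lp ℝ (ENNReal.ofReal b) ν) :
    (∃ K : ℝ, 0 ≤ K ∧ IsPQRegular (⇑T) r r K) ↔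
      (∃ K : ℝ, 0 < K ∧ ∀ (n m : ℕ)
          (x : Fin n → Fin m → Lp ℝ (ENNReal.ofReal a) μ),
          eLpNorm (fun ω' => (∑ i, (∑ j, |T (x i j) ω'| ^ p) ^ (r / p)) ^ (1 / r))
              (ENNReal.ofReal b) ν ≤
            ENNReal.ofReal K *
              eLpNorm (fun ω => (∑ i, (∑ j, |x i j ω| ^ q) ^ (r / q)) ^ (1 / r))
                (ENNReal.ofReal a) μ) := by
  have hr0 : 0 < r := by linarith
  constructor
  · rintro ⟨K, -, hK⟩
    obtain ⟨t, hqt, htp, ht1, ht2⟩ := hint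
    have ht0 : 0 < t := by linarith
    obtain ⟨K', hK'⟩ : ∃ K' : ℝ, ∀ (n m : ℕ) (x : Fin n → Fin m → Lp ℝ (ENNReal.ofReal a) μ),
        eLpNorm (fun ω' => mixedNorm r t fun i j => T (x i j) ω') (ENNReal.ofReal b) ν ≤
          ENNReal.ofReal K' *
            eLpNorm (fun ω => mixedNorm r t fun i j => x i j ω) (ENNReal.ofReal a) μ := by
      rcases le_total r 2 with h | h
      · rw [min_eq_left h] at ht1
        rw [max_eq_right h] at ht2
        exact hK.exists_mixedNorm_le_of_le_two hr0 ht1 ht2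
      · rw [min_eq_right h] at ht1
        rw [max_eq_left h] at ht2
        exact hK.exists_mixedNorm_le_of_two_le ht1 ht2 ENNReal.ofReal_ne_top
    refine ⟨max K' 1, by positivity, fun n m x => ?_⟩
    calc _ ≤ eLpNorm (fun ω' => mixedNorm r t fun i j => T (x i j) ω') (ENNReal.ofReal b) ν := by
          refine eLpNorm_mono_real fun ω' => ?_
          rw [Real.norm_of_nonneg (by positivity)]
          exact mixedNorm_anti hr0 ht0 htp fun i j => T (x i j) ω'
      _ ≤ ENNReal.ofReal K' *
            eLpNorm (fun ω => mixedNorm r t fun i j => x i j ω) (ENNReal.ofReal a) μ := hK' n m x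
      _ ≤ _ := by
          refine mul_le_mul' (ENNReal.ofReal_le_ofReal (le_max_left _ _))
            (eLpNorm_mono_real fun ω => ?_)
          rw [Real.norm_of_nonneg (mixedNorm_nonneg _)]
          exact mixedNorm_anti hr0 (by linarith) hqt fun i j => x i j ω
  · rintro ⟨K, hK0, hK⟩
    refine ⟨K, hK0.le, fun n f => ?_⟩
    have hcollapse : ∀ {s y : ℝ}, 0 < s → (|y| ^ s) ^ (r / s) = |y| ^ r := fun {s y} hs => by
      rw [← Real.rpow_mul (abs_nonneg _), mul_div_cancel₀ _ hs.ne']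
    have h := hK n 1 fun i _ => f i
    simpa only [Finset.univ_unique, Finset.sum_singleton, hcollapse (show 0 < p by linarith),
      hcollapse (show 0 < q by linarith)] using h
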